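/- There exist two non-congruent convex (but not strictly convex) C^∞-smooth spheres S and S′ immersed in ℝ³ and a diffeomorphism φ: S → S′ such that at every p ∈ S the Gauss map of S at p equals the Gauss map of S′ at φ(p) and the principal curvatures of S at p equal those of S′ at φ(p); in particular S and S′ have the same prescribed mean curvature function but are not translations of each other. -/

import Mathlib

open RealInnerProductSpace

noncomputable section

abbrev E3 := EuclideanSpace ℝ (Fin 3)

/-- `κ` is a principal curvature of the surface with Gauss map `ν` at the point `p`:
an eigenvalue of the differential of the Gauss map on the tangent plane. -/
def IsPrincipalCurv (ν : E3 → E3) (p : E3) (κ : ℝ) : Prop :=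
  ∃ v : E3, v ≠ 0 ∧ ⟪v, ν p⟫ = 0 ∧ fderiv ℝ ν p v = κ • v

namespace CappedCylinder

open Real Filter Topology
open scoped ContDiff

/-- A smooth convex function vanishing exactly on the nonpositive reals. -/
def cap (t : ℝ) : ℝ := ∫ x in (0 : ℝ)..t, smoothTransition x

lemma cap_zero : cap 0 = 0 := intervalIntegral.integral_same

lemma hasDerivAt_cap (t : ℝ) : HasDerivAt cap (smoothTransition t) t :=
  (smoothTransition.continuous.integral_hasStrictDerivAt 0 t).hasDerivAt

lemma contDiff_cap : ContDiff ℝ ∞ cap := by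
  refine contDiff_infty_iff_deriv.2 ⟨fun t => (hasDerivAt_cap t).differentiableAt, ?_⟩
  rw [funext fun t => (hasDerivAt_cap t).deriv]
  exact smoothTransition.contDiff

lemma convexOn_cap : ConvexOn ℝ Set.univ cap := by
  refine Monotone.convexOn_univ_of_deriv (fun t => (hasDerivAt_cap t).differentiableAt) ?_
  rw [funext fun t => (hasDerivAt_cap t).deriv]
  exact smoothTransition.monotone

lemma cap_tangent (t u : ℝ) : cap t + smoothTransition t * (u - t) ≤ cap u := by
  rcases lt_trichotomy t u with h | rfl | h
  · have := convexOn_cap.le_slope_of_hasDerivAt (Set.mem_univ _) (Set.mem_univ _) h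
      (hasDerivAt_cap t)
    rw [slope_def_field, le_div_iff₀ (sub_pos.2 h)] at this
    linarith
  · simp
  · have := convexOn_cap.slope_le_of_hasDerivAt (Set.mem_univ _) (Set.mem_univ _) h
      (hasDerivAt_cap t)
    rw [slope_def_field, div_le_iff₀ (sub_pos.2 h)] at this
    linarith

lemma cap_nonneg (t : ℝ) : 0 ≤ cap t := by
  simpa [cap_zero] using cap_tangent 0 t

lemma cap_of_nonpos {t : ℝ} (ht : t ≤ 0) : cap t = 0 := by
  have h := cap_tangent t 0
  rw [smoothTransition.zero_of_nonpos ht, cap_zero] at h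
  linarith [cap_nonneg t]

lemma cap_pos {t : ℝ} (ht : 0 < t) : 0 < cap t := by
  have h := cap_tangent (t / 2) t
  have h' : 0 < smoothTransition (t / 2) * (t - t / 2) :=
    mul_pos (smoothTransition.pos_of_pos (by linarith)) (by linarith)
  linarith [cap_nonneg (t / 2)]

lemma sub_one_le_cap (t : ℝ) : t - 1 ≤ cap t := by
  have h := cap_tangent 1 t
  rw [smoothTransition.one] at h
  linarith [cap_nonneg 1]

/-- The height profile: it vanishes exactly on `[0, a]`. -/
def profile (a z : ℝ) : ℝ := cap (-z) + cap (z - a)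

/-- The derivative of the height profile. -/
def slopeProfile (a z : ℝ) : ℝ := -smoothTransition (-z) + smoothTransition (z - a)

lemma contDiff_profile (a : ℝ) : ContDiff ℝ ∞ (profile a) :=
  (contDiff_cap.comp contDiff_neg).add (contDiff_cap.comp (contDiff_id.sub contDiff_const))

lemma contDiff_slopeProfile (a : ℝ) : ContDiff ℝ ∞ (slopeProfile a) :=
  ((smoothTransition.contDiff (n := ⊤)).comp contDiff_neg).neg.add
    ((smoothTransition.contDiff (n := ⊤)).comp (contDiff_id.sub contDiff_const))

lemma profile_tangent (a z w : ℝ) :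
    profile a z + slopeProfile a z * (w - z) ≤ profile a w := by
  have h₁ := cap_tangent (-z) (-w)
  have h₂ := cap_tangent (z - a) (w - a)
  simp only [profile, slopeProfile]
  linarith

lemma profile_nonneg (a z : ℝ) : 0 ≤ profile a z := add_nonneg (cap_nonneg _) (cap_nonneg _)

lemma profile_eq_zero_iff {a z : ℝ} : profile a z = 0 ↔ 0 ≤ z ∧ z ≤ a := by
  constructor
  · intro h
    constructor
    · by_contra! hz
      have := cap_pos (neg_pos.2 hz)
      have := cap_nonneg (z - a)
      simp only [profile] at h
      linarith
    · by_contra! hz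
      have := cap_pos (sub_pos.2 hz)
      have := cap_nonneg (-z)
      simp only [profile] at h
      linarith
  · rintro ⟨h₁, h₂⟩
    rw [profile, cap_of_nonpos (by linarith), cap_of_nonpos (by linarith), add_zero]

lemma slopeProfile_eq_zero {a z : ℝ} (h₁ : 0 ≤ z) (h₂ : z ≤ a) : slopeProfile a z = 0 := by
  rw [slopeProfile, smoothTransition.zero_of_nonpos (by linarith),
    smoothTransition.zero_of_nonpos (by linarith), neg_zero, add_zero]

/-- Stretching heights by `z ↦ z + smoothTransition z` carries the profile of length one to the
profile of length two. -/
lemma profile_stretch (z : ℝ) :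
    profile 2 (z + smoothTransition z) = profile 1 z ∧
      slopeProfile 2 (z + smoothTransition z) = slopeProfile 1 z := by
  rcases le_total z 0 with h₀ | h₀
  · rw [smoothTransition.zero_of_nonpos h₀, add_zero]
    simp only [profile, slopeProfile]
    rw [cap_of_nonpos (t := z - 2) (by linarith), cap_of_nonpos (t := z - 1) (by linarith),
      smoothTransition.zero_of_nonpos (x := z - 2) (by linarith),
      smoothTransition.zero_of_nonpos (x := z - 1) (by linarith)]
    exact ⟨rfl, rfl⟩
  rcases le_total z 1 with h₁ | h₁
  · have := smoothTransition.nonneg z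
    have := smoothTransition.le_one z
    rw [profile_eq_zero_iff.2 ⟨h₀, h₁⟩, slopeProfile_eq_zero h₀ h₁,
      profile_eq_zero_iff.2 ⟨by linarith, by linarith⟩,
      slopeProfile_eq_zero (by linarith) (by linarith)]
    exact ⟨rfl, rfl⟩
  · rw [smoothTransition.one_of_one_le h₁]
    simp only [profile, slopeProfile]
    rw [cap_of_nonpos (t := -(z + 1)) (by linarith), cap_of_nonpos (t := -z) (by linarith),
      smoothTransition.zero_of_nonpos (x := -(z + 1)) (by linarith),
      smoothTransition.zero_of_nonpos (x := -z) (by linarith),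
      show z + 1 - 2 = z - 1 by ring]
    exact ⟨rfl, rfl⟩

/-- The convex defining function of the capped cylinder of length `a`. -/
def level (a : ℝ) (p : E3) : ℝ := p 0 ^ 2 + p 1 ^ 2 + profile a (p 2)

/-- The gradient of `level a`. -/
def grad (a : ℝ) (p : E3) : E3 := !₂[2 * p 0, 2 * p 1, slopeProfile a (p 2)]

/-- The convex body bounded by the capped cylinder of length `a`. -/
def body (a : ℝ) : Set E3 := {p | level a p ≤ 1}

/-- The squared length of the gradient, corrected off the level set `level a p = 1` so that
it is positive everywhere. -/
def weight (a : ℝ) (p : E3) : ℝ :=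
  (2 * p 0) ^ 2 + (2 * p 1) ^ 2 + slopeProfile a (p 2) ^ 2 + (level a p - 1) ^ 2

/-- A globally smooth extension of the outward unit normal of the capped cylinder. -/
def gauss (a : ℝ) (p : E3) : E3 := (√(weight a p))⁻¹ • grad a p

lemma contDiff_coord (i : Fin 3) : ContDiff ℝ ∞ fun p : E3 => p i :=
  contDiff_euclidean.1 contDiff_id i

lemma contDiff_level (a : ℝ) : ContDiff ℝ ∞ (level a) :=
  (((contDiff_coord 0).pow 2).add ((contDiff_coord 1).pow 2)).add
    ((contDiff_profile a).comp (contDiff_coord 2))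

lemma contDiff_grad (a : ℝ) : ContDiff ℝ ∞ (grad a) := by
  refine contDiff_euclidean.2 fun i => ?_
  fin_cases i
  · exact contDiff_const.mul (contDiff_coord 0)
  · exact contDiff_const.mul (contDiff_coord 1)
  · exact (contDiff_slopeProfile a).comp (contDiff_coord 2)

lemma contDiff_weight (a : ℝ) : ContDiff ℝ ∞ (weight a) :=
  ((((contDiff_const.mul (contDiff_coord 0)).pow 2).add
    ((contDiff_const.mul (contDiff_coord 1)).pow 2)).add
    (((contDiff_slopeProfile a).comp (contDiff_coord 2)).pow 2)).add
    (((contDiff_level a).sub contDiff_const).pow 2)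

lemma inner_grad (a : ℝ) (p v : E3) :
    ⟪grad a p, v⟫ = 2 * p 0 * v 0 + 2 * p 1 * v 1 + slopeProfile a (p 2) * v 2 := by
  simp [grad, PiLp.inner_apply, Fin.sum_univ_three]
  ring

lemma level_tangent (a : ℝ) (p q : E3) : level a p + ⟪grad a p, q - p⟫ ≤ level a q := by
  have h := profile_tangent a (p 2) (q 2)
  rw [inner_grad]
  simp only [level, PiLp.sub_apply]
  nlinarith [sq_nonneg (q 0 - p 0), sq_nonneg (q 1 - p 1)]

lemma level_zero {a : ℝ} (ha : 0 ≤ a) : level a 0 = 0 := by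
  simp [level, profile_eq_zero_iff.2 ⟨le_rfl, ha⟩]

lemma level_le_inner_grad {a : ℝ} (ha : 0 ≤ a) (p : E3) : level a p ≤ ⟪grad a p, p⟫ := by
  have h := level_tangent a p 0
  rw [level_zero ha, zero_sub, inner_neg_right] at h
  linarith

lemma weight_pos {a : ℝ} (ha : 0 ≤ a) (p : E3) : 0 < weight a p := by
  by_contra! h
  have h' : weight a p = (2 * p 0) ^ 2 + (2 * p 1) ^ 2 + slopeProfile a (p 2) ^ 2 +
    (level a p - 1) ^ 2 := rfl
  have h₀ := sq_nonneg (2 * p 0)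
  have h₁ := sq_nonneg (2 * p 1)
  have h₂ := sq_nonneg (slopeProfile a (p 2))
  have h₃ := sq_nonneg (level a p - 1)
  have e₀ : 2 * p 0 = 0 := pow_eq_zero_iff two_ne_zero |>.1 (by linarith)
  have e₁ : 2 * p 1 = 0 := pow_eq_zero_iff two_ne_zero |>.1 (by linarith)
  have e₂ : slopeProfile a (p 2) = 0 := pow_eq_zero_iff two_ne_zero |>.1 (by linarith)
  have e₃ : level a p - 1 = 0 := pow_eq_zero_iff two_ne_zero |>.1 (by linarith)
  have := level_le_inner_grad ha p
  rw [inner_grad, e₀, e₁, e₂] at this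
  linarith

lemma contDiff_gauss {a : ℝ} (ha : 0 ≤ a) : ContDiff ℝ ∞ (gauss a) :=
  (((contDiff_weight a).sqrt fun p => (weight_pos ha p).ne').inv
    fun p => (sqrt_pos.2 (weight_pos ha p)).ne').smul (contDiff_grad a)

lemma frontier_body {a : ℝ} (ha : 0 ≤ a) : frontier (body a) = {p | level a p = 1} := by
  refine (frontier_le_subset_eq (contDiff_level a).continuous continuous_const).antisymm ?_
  intro p hp
  have hp : level a p = 1 := hp
  refine ⟨subset_closure hp.le, fun hi => ?_⟩
  have hc : Tendsto (fun t : ℝ => p + t • p) (𝓝[>] 0) (𝓝 p) := by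
    have : ContinuousAt (fun t : ℝ => p + t • p) 0 := by fun_prop
    simpa using this.tendsto.mono_left nhdsWithin_le_nhds
  obtain ⟨t, ht, ht0⟩ :=
    ((hc.eventually (mem_interior_iff_mem_nhds.1 hi)).and self_mem_nhdsWithin).exists
  have ht : level a (p + t • p) ≤ 1 := ht
  have ht0 : 0 < t := ht0
  have h := level_tangent a p (p + t • p)
  have hg := level_le_inner_grad ha p
  rw [add_sub_cancel_left, inner_smul_right] at h
  nlinarith

lemma convex_body (a : ℝ) : Convex ℝ (body a) := by
  intro p hp q hq s t hs ht hst
  have hp : level a p ≤ 1 := hp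
  have hq : level a q ≤ 1 := hq
  have h₁ := level_tangent a (s • p + t • q) p
  have h₂ := level_tangent a (s • p + t • q) q
  rw [inner_sub_right] at h₁ h₂
  have h₃ : ⟪grad a (s • p + t • q), s • p + t • q⟫ =
      s * ⟪grad a (s • p + t • q), p⟫ + t * ⟪grad a (s • p + t • q), q⟫ := by
    rw [inner_add_right, inner_smul_right, inner_smul_right]
  change level a (s • p + t • q) ≤ 1
  generalize ⟪grad a (s • p + t • q), s • p + t • q⟫ = x at *
  generalize ⟪grad a (s • p + t • q), p⟫ = y at *
  generalize ⟪grad a (s • p + t • q), q⟫ = z at *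
  generalize level a (s • p + t • q) = l at *
  obtain rfl : t = 1 - s := by linarith
  nlinarith [mul_le_mul_of_nonneg_left h₁ hs, mul_le_mul_of_nonneg_left h₂ ht,
    mul_le_mul_of_nonneg_left hp hs, mul_le_mul_of_nonneg_left hq ht]

lemma isCompact_body {a : ℝ} (ha : 0 ≤ a) : IsCompact (body a) := by
  refine Metric.isCompact_of_isClosed_isBounded
    (isClosed_le (contDiff_level a).continuous continuous_const) ?_
  refine (Metric.isBounded_closedBall (x := 0) (r := a + 3)).subset fun p hp => ?_
  have hp : p 0 ^ 2 + p 1 ^ 2 + (cap (-p 2) + cap (p 2 - a)) ≤ 1 := hp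
  have h₁ := sub_one_le_cap (-p 2)
  have h₂ := sub_one_le_cap (p 2 - a)
  have h₃ := cap_nonneg (-p 2)
  have h₄ := cap_nonneg (p 2 - a)
  have h₅ := sq_nonneg (p 0)
  have h₆ := sq_nonneg (p 1)
  rw [mem_closedBall_zero_iff, EuclideanSpace.norm_eq, Fin.sum_univ_three]
  simp only [norm_eq_abs, sq_abs]
  refine sqrt_le_iff.2 ⟨by linarith, ?_⟩
  have h₇ : p 2 ^ 2 ≤ (a + 2) ^ 2 := sq_le_sq' (by linarith) (by linarith)
  nlinarith

lemma interior_body_nonempty {a : ℝ} (ha : 0 ≤ a) : (interior (body a)).Nonempty := by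
  have ho : IsOpen {p | level a p < 1} :=
    isOpen_lt (contDiff_level a).continuous continuous_const
  refine ⟨0, interior_maximal (fun p (hp : level a p < 1) => hp.le) ho ?_⟩
  change level a 0 < 1
  rw [level_zero ha]
  exact zero_lt_one

lemma frontier_homeomorph_sphere {K : Set E3} (hc : Convex ℝ K) (hK : IsCompact K)
    (hi : (interior K).Nonempty) : Nonempty (frontier K ≃ₜ Metric.sphere (0 : E3) 1) := by
  obtain ⟨h, -, -, hf⟩ :=
    exists_homeomorph_image_interior_closure_frontier_eq_unitBall hc hi hK.isBounded
  exact ⟨(h.image _).trans (Homeomorph.setCongr hf)⟩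

lemma gauss_spec {a : ℝ} (ha : 0 ≤ a) {p : E3} (hp : p ∈ frontier (body a)) :
    ‖gauss a p‖ = 1 ∧ ∀ q ∈ body a, ⟪gauss a p, q - p⟫ ≤ 0 := by
  rw [frontier_body ha] at hp
  have hp : level a p = 1 := hp
  have hw := sqrt_pos.2 (weight_pos ha p)
  constructor
  · have hn : ‖grad a p‖ = √(weight a p) := by
      rw [EuclideanSpace.norm_eq, Fin.sum_univ_three]
      simp only [norm_eq_abs, sq_abs]
      simp [grad, weight, hp]
    rw [gauss, norm_smul, hn, norm_inv, norm_of_nonneg hw.le, inv_mul_cancel₀ hw.ne']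
  · intro q hq
    have hq : level a q ≤ 1 := hq
    have h := level_tangent a p q
    rw [gauss, real_inner_smul_left]
    exact mul_nonpos_of_nonneg_of_nonpos (inv_nonneg.2 hw.le) (by linarith)

/-- The unit vector along the axis of the cylinder. -/
def axis : E3 := EuclideanSpace.single 2 1

lemma gauss_congr {a b : ℝ} {p q : E3} (h₀ : p 0 = q 0) (h₁ : p 1 = q 1)
    (h₂ : profile a (p 2) = profile b (q 2))
    (h₃ : slopeProfile a (p 2) = slopeProfile b (q 2)) : gauss a p = gauss b q := by
  simp only [gauss, weight, grad, level, h₀, h₁, h₂, h₃]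

lemma fderiv_gauss_axis {a : ℝ} (ha : 0 ≤ a) {p : E3} (h₀ : 0 < p 2) (h₁ : p 2 < a) :
    fderiv ℝ (gauss a) p axis = 0 := by
  have hd : HasFDerivAt (gauss a) (fderiv ℝ (gauss a) p) (p + (0 : ℝ) • axis) := by
    rw [zero_smul, add_zero]
    exact ((contDiff_gauss ha).differentiable (by simp) p).hasFDerivAt
  have hl : HasDerivAt (fun t : ℝ => p + t • axis) axis 0 := by
    simpa using ((hasDerivAt_id (0 : ℝ)).smul_const axis).const_add p
  refine (hd.comp_hasDerivAt (0 : ℝ) hl).unique ?_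
  refine (hasDerivAt_const (0 : ℝ) (gauss a p)).congr_of_eventuallyEq ?_
  have hc : Tendsto (fun t : ℝ => p 2 + t) (𝓝 0) (𝓝 (p 2)) := by
    have : ContinuousAt (fun t : ℝ => p 2 + t) 0 := by fun_prop
    simpa using this.tendsto
  filter_upwards [hc.eventually (Ioo_mem_nhds h₀ h₁)] with t ht
  have e : (p + t • axis) 2 = p 2 + t := by simp [axis]
  refine gauss_congr (by simp [axis]) (by simp [axis]) ?_ ?_
  · rw [e, profile_eq_zero_iff.2 ⟨ht.1.le, ht.2.le⟩, profile_eq_zero_iff.2 ⟨h₀.le, h₁.le⟩]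
  · rw [e, slopeProfile_eq_zero ht.1.le ht.2.le, slopeProfile_eq_zero h₀.le h₁.le]

/-- The map stretching the cylinder of length one to the cylinder of length two. -/
def stretch (p : E3) : E3 := p + smoothTransition (p 2) • axis

lemma contDiff_stretch : ContDiff ℝ ∞ stretch :=
  contDiff_id.add
    (((smoothTransition.contDiff (n := ⊤)).comp (contDiff_coord 2)).smul contDiff_const)

lemma stretch_zero (p : E3) : stretch p 0 = p 0 := by simp [stretch, axis]

lemma stretch_one (p : E3) : stretch p 1 = p 1 := by simp [stretch, axis]

lemma stretch_two (p : E3) : stretch p 2 = p 2 + smoothTransition (p 2) := by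
  simp [stretch, axis]

lemma level_stretch (p : E3) : level 2 (stretch p) = level 1 p := by
  rw [level, stretch_zero, stretch_one, stretch_two, (profile_stretch _).1, level]

lemma gauss_stretch (p : E3) : gauss 2 (stretch p) = gauss 1 p :=
  gauss_congr (stretch_zero p) (stretch_one p)
    (by rw [stretch_two, (profile_stretch _).1]) (by rw [stretch_two, (profile_stretch _).2])

lemma stretch_bijective : Function.Bijective stretch := by
  constructor
  · intro p q h
    have h₂ : p 2 = q 2 := by
      have e : p 2 + smoothTransition (p 2) = q 2 + smoothTransition (q 2) := by
        rw [← stretch_two, ← stretch_two, h]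
      rcases lt_trichotomy (p 2) (q 2) with hlt | heq | hlt
      · linarith [smoothTransition.monotone hlt.le]
      · exact heq
      · linarith [smoothTransition.monotone hlt.le]
    simpa [stretch, h₂] using h
  · intro q
    obtain ⟨z, -, hz⟩ := intermediate_value_Icc (show q 2 - 1 ≤ q 2 by linarith)
      (f := fun z => z + smoothTransition z)
      (continuous_id.add smoothTransition.continuous).continuousOn
      (show q 2 ∈ _ from ⟨by linarith [smoothTransition.le_one (q 2 - 1)],
        by linarith [smoothTransition.nonneg (q 2)]⟩)
    have e : (q - smoothTransition z • axis) 2 = z := by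
      simp only [axis, PiLp.sub_apply, PiLp.smul_apply, PiLp.single_apply]
      simp
      linarith
    exact ⟨q - smoothTransition z • axis, by rw [stretch, e, sub_add_cancel]⟩

lemma deriv_smoothTransition_eq_zero {z : ℝ} (hz : z ≤ 0 ∨ 1 ≤ z) :
    deriv smoothTransition z = 0 := by
  rcases hz with hz | hz
  · refine IsLocalMin.deriv_eq_zero (Eventually.of_forall fun w => ?_)
    rw [smoothTransition.zero_of_nonpos hz]
    exact smoothTransition.nonneg w
  · refine IsLocalMax.deriv_eq_zero (Eventually.of_forall fun w => ?_)
    rw [smoothTransition.one_of_one_le hz]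
    exact smoothTransition.le_one w

lemma fderiv_stretch (p v : E3) :
    fderiv ℝ stretch p v = v + (deriv smoothTransition (p 2) * v 2) • axis := by
  have h₁ : HasFDerivAt (fun q : E3 => q 2) (EuclideanSpace.proj (𝕜 := ℝ) (2 : Fin 3)) p :=
    (EuclideanSpace.proj (𝕜 := ℝ) (2 : Fin 3)).hasFDerivAt
  have h₂ : HasDerivAt smoothTransition (deriv smoothTransition (p 2)) (p 2) :=
    ((smoothTransition.contDiff (n := 1)).differentiable (by simp) _).hasDerivAt
  have h₃ := (hasFDerivAt_id p).add ((h₂.comp_hasFDerivAt p h₁).smul_const axis)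
  have h₄ : HasFDerivAt stretch _ p := h₃
  rw [h₄.fderiv]
  simp

lemma fderiv_gauss_stretch (p : E3) :
    fderiv ℝ (gauss 2) (stretch p) = fderiv ℝ (gauss 1) p := by
  have h : gauss 1 = gauss 2 ∘ stretch := funext fun q => (gauss_stretch q).symm
  ext1 v
  rw [h, fderiv_comp p ((contDiff_gauss zero_le_two).differentiable (by simp) _)
    (contDiff_stretch.differentiable (by simp) _), ContinuousLinearMap.comp_apply,
    fderiv_stretch, map_add, map_smul]
  by_cases hz : p 2 ≤ 0 ∨ 1 ≤ p 2
  · rw [deriv_smoothTransition_eq_zero hz, zero_mul, zero_smul, add_zero]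
  · push Not at hz
    have := smoothTransition.nonneg (p 2)
    have := smoothTransition.le_one (p 2)
    rw [fderiv_gauss_axis zero_le_two (by rw [stretch_two]; linarith)
      (by rw [stretch_two]; linarith), smul_zero, add_zero]

lemma isPrincipalCurv_stretch_iff (p : E3) (κ : ℝ) :
    IsPrincipalCurv (gauss 1) p κ ↔ IsPrincipalCurv (gauss 2) (stretch p) κ := by
  simp only [IsPrincipalCurv, gauss_stretch, fderiv_gauss_stretch]

lemma stretch_bijOn : Set.BijOn stretch (frontier (body 1)) (frontier (body 2)) := by
  rw [frontier_body zero_le_one, frontier_body zero_le_two]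
  refine ⟨fun p hp => (level_stretch p).trans hp, stretch_bijective.1.injOn, fun q hq => ?_⟩
  obtain ⟨p, rfl⟩ := stretch_bijective.2 q
  exact ⟨p, (level_stretch p).symm.trans hq, rfl⟩

lemma exists_isPrincipalCurv_zero :
    ∃ p ∈ frontier (body 1), IsPrincipalCurv (gauss 1) p 0 := by
  have h₂ : (!₂[1, 0, 1 / 2] : E3) 2 = 1 / 2 := rfl
  refine ⟨!₂[1, 0, 1 / 2], ?_, axis, ?_, ?_, ?_⟩
  · rw [frontier_body zero_le_one]
    change level 1 _ = 1
    rw [level, h₂, profile_eq_zero_iff.2 (by norm_num)]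
    simp
  · simp [axis]
  · rw [gauss, real_inner_comm, real_inner_smul_left, inner_grad, h₂,
      slopeProfile_eq_zero (by norm_num) (by norm_num)]
    simp [axis]
  · rw [zero_smul]
    exact fderiv_gauss_axis zero_le_one (by rw [h₂]; norm_num) (by rw [h₂]; norm_num)

lemma body_ne_translate (v : E3) : body 2 ≠ (fun x => x + v) '' body 1 := by
  intro h
  have key : ∀ x z : ℝ, x ^ 2 = 1 → 0 ≤ z → z ≤ 2 →
      (x - v 0) ^ 2 + v 1 ^ 2 + profile 1 (z - v 2) ≤ 1 := by
    intro x z hx hz hz'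
    have hm : (!₂[x, 0, z] : E3) ∈ body 2 := by
      change x ^ 2 + 0 ^ 2 + profile 2 z ≤ 1
      rw [profile_eq_zero_iff.2 ⟨hz, hz'⟩, hx]
      norm_num
    rw [h] at hm
    obtain ⟨p, hp, e⟩ := hm
    have hp : p 0 ^ 2 + p 1 ^ 2 + profile 1 (p 2) ≤ 1 := hp
    have e : p + v = !₂[x, 0, z] := e
    have e₀ : p 0 + v 0 = x := congrArg (fun q : E3 => q 0) e
    have e₁ : p 1 + v 1 = 0 := congrArg (fun q : E3 => q 1) e
    have e₂ : p 2 + v 2 = z := congrArg (fun q : E3 => q 2) e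
    rw [← e₀, ← e₂, add_sub_cancel_right, add_sub_cancel_right,
      show v 1 = -p 1 by linarith, neg_sq]
    exact hp
  have hzero : ∀ z : ℝ, 0 ≤ z → z ≤ 2 → profile 1 (z - v 2) = 0 := by
    intro z hz hz'
    have h₁ := key 1 z (by norm_num) hz hz'
    have h₂ := key (-1) z (by norm_num) hz hz'
    nlinarith [profile_nonneg 1 (z - v 2), sq_nonneg (v 0), sq_nonneg (v 1)]
  have h₀ := profile_eq_zero_iff.1 (hzero 0 le_rfl zero_le_two)
  have h₂ := profile_eq_zero_iff.1 (hzero 2 zero_le_two le_rfl)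
  linarith [h₀.1, h₂.2]

end CappedCylinder

/-- There exist two non-congruent convex (but not strictly convex) smooth spheres in `ℝ³`
with a diffeomorphism matching Gauss maps and principal curvatures pointwise; in
particular they have the same prescribed mean curvature but are not translates. -/
theorem convex_spheres_same_prescribed_curvatures :
    ∃ (S S' : Set E3) (ν ν' φ : E3 → E3),
      -- S and S' are compact convex bodies (convex spheres)
      Convex ℝ S ∧ IsCompact S ∧ (interior S).Nonempty ∧
      Convex ℝ S' ∧ IsCompact S' ∧ (interior S').Nonempty ∧
      -- their boundaries are topological spheres
      Nonempty (frontier S ≃ₜ Metric.sphere (0 : E3) 1) ∧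
      Nonempty (frontier S' ≃ₜ Metric.sphere (0 : E3) 1) ∧
      -- smooth outward unit normals (Gauss maps)
      ContDiff ℝ (⊤ : ℕ∞) ν ∧ ContDiff ℝ (⊤ : ℕ∞) ν' ∧
      (∀ p ∈ frontier S, ‖ν p‖ = 1 ∧ ∀ q ∈ S, ⟪ν p, q - p⟫ ≤ 0) ∧
      (∀ p ∈ frontier S', ‖ν' p‖ = 1 ∧ ∀ q ∈ S', ⟪ν' p, q - p⟫ ≤ 0) ∧
      -- not strictly convex: a vanishing principal curvature somewhere
      (∃ p ∈ frontier S, IsPrincipalCurv ν p 0) ∧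
      -- φ is a smooth diffeomorphism between the boundaries
      ContDiff ℝ (⊤ : ℕ∞) φ ∧ Set.BijOn φ (frontier S) (frontier S') ∧
      -- φ matches the Gauss maps
      (∀ p ∈ frontier S, ν' (φ p) = ν p) ∧
      -- φ matches the principal curvatures
      (∀ p ∈ frontier S, ∀ κ : ℝ,
        IsPrincipalCurv ν p κ ↔ IsPrincipalCurv ν' (φ p) κ) ∧
      -- S and S' are not translates of each other
      (∀ v : E3, S' ≠ (fun x => x + v) '' S) := by
  open CappedCylinder in
  exact ⟨body 1, body 2, gauss 1, gauss 2, stretch,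
    convex_body 1, isCompact_body zero_le_one, interior_body_nonempty zero_le_one,
    convex_body 2, isCompact_body zero_le_two, interior_body_nonempty zero_le_two,
    frontier_homeomorph_sphere (convex_body 1) (isCompact_body zero_le_one)
      (interior_body_nonempty zero_le_one),
    frontier_homeomorph_sphere (convex_body 2) (isCompact_body zero_le_two)
      (interior_body_nonempty zero_le_two),
    contDiff_gauss zero_le_one, contDiff_gauss zero_le_two,
    fun _ => gauss_spec zero_le_one, fun _ => gauss_spec zero_le_two,
    exists_isPrincipalCurv_zero, contDiff_stretch, stretch_bijOn,
    fun p _ => gauss_stretch p, fun p _ => isPrincipalCurv_stretch_iff p, body_ne_translate⟩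

end
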